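/- arXiv:2203.07458 — 4 statements merged into one kernel-verified Lean document; each statement's English description precedes it below -/
import Mathlib

section
/- Let k, σ > 0, T₀ ∈ ℝ and b ≥ 0. Define φ₁ := √(k² + 2σ²) and φ₂ := (k + φ₁)/2, and define N : ℝ → ℝ by N(t) := (b·φ₁ + (exp(φ₁(T₀ − t)) − 1)·(1 + b(φ₁ − φ₂))) / (φ₁ + φ₂·(exp(φ₁(T₀ − t)) − 1)·(1 + b(φ₁ − φ₂))). Then N(T₀) = b, the denominator is nonzero for every t ≤ T₀, and for every t ≤ T₀ the function N is differentiable at t with N′(t) = −1 + k·N(t) + (σ²/2)·N(t)². (This is the Riccati equation associated with the x-factor bond moments of the CIR− model, with generic terminal value b.) -/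
/-- The explicit function `N` solves the backward Riccati ODE
`N′(t) = −1 + k·N(t) + (σ²/2)·N(t)²` on `(-∞, T₀]` with terminal condition `N(T₀) = b`,
for the x-factor of the CIR− model, where `φ₁ = √(k² + 2σ²)` and `φ₂ = (k + φ₁)/2`. -/
theorem cir_minus_x_factor_riccati
    (k σ T₀ b : ℝ) (hk : 0 < k) (hσ : 0 < σ) (hb : 0 ≤ b)
    (φ₁ φ₂ : ℝ)
    (hφ₁ : φ₁ = Real.sqrt (k ^ 2 + 2 * σ ^ 2))
    (hφ₂ : φ₂ = (k + φ₁) / 2)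
    (N : ℝ → ℝ)
    (hN : ∀ t, N t =
      (b * φ₁ + (Real.exp (φ₁ * (T₀ - t)) - 1) * (1 + b * (φ₁ - φ₂))) /
      (φ₁ + φ₂ * (Real.exp (φ₁ * (T₀ - t)) - 1) * (1 + b * (φ₁ - φ₂)))) :
    N T₀ = b ∧
    (∀ t ≤ T₀, φ₁ + φ₂ * (Real.exp (φ₁ * (T₀ - t)) - 1) * (1 + b * (φ₁ - φ₂)) ≠ 0) ∧
    (∀ t ≤ T₀, HasDerivAt N (-1 + k * N t + σ ^ 2 / 2 * (N t) ^ 2) t) := by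
  have hsq : φ₁ ^ 2 = k ^ 2 + 2 * σ ^ 2 := by
    rw [hφ₁]
    exact Real.sq_sqrt (by positivity)
  have hpos : 0 < φ₁ := by
    rw [hφ₁]
    positivity
  have hk_lt : k < φ₁ := by nlinarith [pow_pos hσ 2]
  have hφ₂_pos : 0 < φ₂ := by linarith
  have hc : 0 < 1 + b * (φ₁ - φ₂) := by
    have := mul_nonneg hb (show 0 ≤ φ₁ - φ₂ by linarith)
    linarith
  have hden : ∀ t ≤ T₀,
      φ₁ + φ₂ * (Real.exp (φ₁ * (T₀ - t)) - 1) * (1 + b * (φ₁ - φ₂)) ≠ 0 := by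
    intro t ht
    have hexp : 0 ≤ Real.exp (φ₁ * (T₀ - t)) - 1 :=
      sub_nonneg.2 (Real.one_le_exp (mul_nonneg hpos.le (sub_nonneg.2 ht)))
    positivity
  refine ⟨?_, hden, fun t ht => ?_⟩
  · rw [hN]
    simp [hpos.ne']
  · have hD := hden t ht
    have hE : HasDerivAt (fun s => Real.exp (φ₁ * (T₀ - s)) - 1)
        (Real.exp (φ₁ * (T₀ - t)) * (φ₁ * -1)) t :=
      ((((hasDerivAt_id t).const_sub T₀).const_mul φ₁).exp).sub_const 1
    have hquot := ((hE.mul_const (1 + b * (φ₁ - φ₂))).const_add (b * φ₁)).fun_div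
      (((hE.const_mul φ₂).mul_const (1 + b * (φ₁ - φ₂))).const_add φ₁) hD
    rw [← funext hN] at hquot
    refine hquot.congr_deriv ?_
    have hk_eq : k = φ₂ - (φ₁ - φ₂) := by linarith
    have hσ_eq : σ ^ 2 / 2 = φ₂ * (φ₁ - φ₂) := by
      rw [hφ₂]
      linarith
    rw [hN t, hσ_eq, hk_eq]
    clear hquot hE
    generalize Real.exp (φ₁ * (T₀ - t)) = e at hD ⊢
    generalize hd : φ₁ + φ₂ * (e - 1) * (1 + b * (φ₁ - φ₂)) = d at hD ⊢
    field_simp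
    rw [← hd]
    ring
end

section
/- Let k, σ, θ > 0, T₀ ∈ ℝ, a > 0 and b ≥ 0. Define φ₁ := √(k² + 2σ²), φ₂ := (k + φ₁)/2, φ₃ := 2kθ/σ², define N : ℝ → ℝ by N(t) := (b·φ₁ + (exp(φ₁(T₀ − t)) − 1)·(1 + b(φ₁ − φ₂))) / (φ₁ + φ₂·(exp(φ₁(T₀ − t)) − 1)·(1 + b(φ₁ − φ₂))), and define M : ℝ → ℝ by M(t) := a·( φ₁·exp(φ₂(T₀ − t)) / (φ₁ + φ₂·(exp(φ₁(T₀ − t)) − 1)·(1 + b(φ₁ − φ₂))) )^{φ₃}. Then M(T₀) = a, M(t) > 0 for t ≤ T₀, and for every t ≤ T₀ the function M is differentiable at t with M′(t) = k·θ·N(t)·M(t). -/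
/-- The explicit function `M` solves the linear ODE
`M′(t) = k·θ·N(t)·M(t)` on `(-∞, T₀]` with terminal condition `M(T₀) = a`,
where `N` is the explicit solution of the x-factor Riccati equation of the CIR− model,
`φ₁ = √(k² + 2σ²)`, `φ₂ = (k + φ₁)/2`, `φ₃ = 2kθ/σ²`. -/
theorem cir_minus_x_factor_linear_ode
    (k σ θ T₀ a b : ℝ) (hk : 0 < k) (hσ : 0 < σ) (hθ : 0 < θ) (ha : 0 < a) (hb : 0 ≤ b)
    (φ₁ φ₂ φ₃ : ℝ)
    (hφ₁ : φ₁ = Real.sqrt (k ^ 2 + 2 * σ ^ 2))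
    (hφ₂ : φ₂ = (k + φ₁) / 2)
    (hφ₃ : φ₃ = 2 * k * θ / σ ^ 2)
    (N : ℝ → ℝ)
    (hN : ∀ t, N t =
      (b * φ₁ + (Real.exp (φ₁ * (T₀ - t)) - 1) * (1 + b * (φ₁ - φ₂))) /
      (φ₁ + φ₂ * (Real.exp (φ₁ * (T₀ - t)) - 1) * (1 + b * (φ₁ - φ₂))))
    (M : ℝ → ℝ)
    (hM : ∀ t, M t = a *
      (φ₁ * Real.exp (φ₂ * (T₀ - t)) /
        (φ₁ + φ₂ * (Real.exp (φ₁ * (T₀ - t)) - 1) * (1 + b * (φ₁ - φ₂)))) ^ φ₃) :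
    M T₀ = a ∧
    (∀ t ≤ T₀, 0 < M t) ∧
    (∀ t ≤ T₀, HasDerivAt M (k * θ * N t * M t) t) := by
  have hφ₁_sq : φ₁ ^ 2 = k ^ 2 + 2 * σ ^ 2 := by
    rw [hφ₁]
    exact Real.sq_sqrt (by positivity)
  have hk_lt : k < φ₁ := by
    rw [hφ₁]
    exact Real.lt_sqrt_of_sq_lt (by nlinarith [pow_pos hσ 2])
  have hφ₁_pos : 0 < φ₁ := hk.trans hk_lt
  have hφ₂_pos : 0 < φ₂ := by linarith
  have hφ_prod : φ₂ * (φ₁ - φ₂) = σ ^ 2 / 2 := by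
    rw [hφ₂]
    linear_combination hφ₁_sq / 4
  have hφ₃_mul : σ ^ 2 / 2 * φ₃ = k * θ := by
    rw [hφ₃]
    field_simp
  have hc_pos : 0 < 1 + b * (φ₁ - φ₂) := by
    have : 0 ≤ b * (φ₁ - φ₂) := mul_nonneg hb (by linarith)
    linarith
  have hden_pos : ∀ t ≤ T₀,
      0 < φ₁ + φ₂ * (Real.exp (φ₁ * (T₀ - t)) - 1) * (1 + b * (φ₁ - φ₂)) := by
    intro t ht
    have hexp : 0 ≤ Real.exp (φ₁ * (T₀ - t)) - 1 :=
      sub_nonneg.2 (Real.one_le_exp (mul_nonneg hφ₁_pos.le (sub_nonneg.2 ht)))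
    positivity
  have hbase_pos : ∀ t ≤ T₀, 0 < φ₁ * Real.exp (φ₂ * (T₀ - t)) /
      (φ₁ + φ₂ * (Real.exp (φ₁ * (T₀ - t)) - 1) * (1 + b * (φ₁ - φ₂))) :=
    fun t ht => div_pos (by positivity) (hden_pos t ht)
  refine ⟨?_, fun t ht => ?_, fun t ht => ?_⟩
  · rw [hM]
    simp [hφ₁_pos.ne']
  · rw [hM]
    exact mul_pos ha (Real.rpow_pos_of_pos (hbase_pos t ht) _)
  · have hexp : ∀ c : ℝ, HasDerivAt (fun s => Real.exp (c * (T₀ - s)))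
        (Real.exp (c * (T₀ - t)) * (c * -1)) t := fun c =>
      (((hasDerivAt_id t).const_sub T₀).const_mul c).exp
    have hden := (hden_pos t ht).ne'
    have hbase := ((hexp φ₂).const_mul φ₁).fun_div
      (((((hexp φ₁).sub_const 1).const_mul φ₂).mul_const (1 + b * (φ₁ - φ₂))).const_add φ₁) hden
    have hM_deriv := (hbase.rpow_const (p := φ₃) (Or.inl (hbase_pos t ht).ne')).const_mul a
    rw [← funext hM] at hM_deriv
    refine hM_deriv.congr_deriv ?_
    rw [hM, hN, Real.rpow_sub_one (hbase_pos t ht).ne', ← hφ₃_mul, ← hφ_prod]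
    generalize (φ₁ * Real.exp (φ₂ * (T₀ - t)) /
      (φ₁ + φ₂ * (Real.exp (φ₁ * (T₀ - t)) - 1) * (1 + b * (φ₁ - φ₂)))) ^ φ₃ = R
    have hE := (Real.exp_pos (φ₂ * (T₀ - t))).ne'
    field_simp
    ring
end

section
/- Let H_n denote the probabilists' Hermite polynomials and φ(x) = (2π)^{−1/2} e^{−x²/2}. Let n ≥ 3, c₁ ∈ ℝ, c₂ > 0, a ∈ ℝ, and set d := (c₁ − a)/√c₂. Then ∫_a^∞ x · (1/√c₂) · H_n((x − c₁)/√c₂) · φ((x − c₁)/√c₂) dx = (−1)^{n−1} · φ(d) · ( a·H_{n−1}(d) − √c₂·H_{n−2}(d) ). -/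
open Polynomial
open MeasureTheory

theorem hermite_comp_neg_X (n : ℕ) :
    (hermite n).comp (-X) = (-1) ^ n * hermite n := by
  induction n with
  | zero => simp
  | succ n ih =>
    have h := congrArg derivative ih
    have hd : derivative ((-1 : ℤ[X]) ^ n) = 0 := by
      rcases neg_one_pow_eq_or ℤ[X] n with h | h <;> simp [h]
    rw [derivative_comp, derivative_mul, hd] at h
    simp only [derivative_neg, derivative_X] at h
    rw [hermite_succ, sub_comp, mul_comp, X_comp, ih, pow_succ]
    linear_combination h

theorem aeval_neg_hermite (n : ℕ) (x : ℝ) :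
    aeval (-x) (hermite n) = (-1) ^ n * aeval x (hermite n) := by
  have h := congrArg (aeval x) (hermite_comp_neg_X n)
  simpa [aeval_comp] using h

theorem hasDerivAt_hermite_mul_exp (n : ℕ) (x : ℝ) :
    HasDerivAt (fun y : ℝ => aeval y (hermite n) * Real.exp (-y ^ 2 / 2))
      (-(aeval x (hermite (n + 1)) * Real.exp (-x ^ 2 / 2))) x := by
  have hq : HasDerivAt (fun y : ℝ => -y ^ 2 / 2) (-x) x := by
    refine ((hasDerivAt_pow 2 x).neg.div_const 2).congr_deriv ?_
    norm_num
    ring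
  refine (((hermite n).hasDerivAt_aeval x).mul hq.exp).congr_deriv ?_
  simp only [hermite_succ, map_sub, map_mul, aeval_X]
  ring

theorem integrable_eval_mul_exp_neg_sq_div_two (p : ℝ[X]) :
    Integrable (fun x : ℝ => p.eval x * Real.exp (-x ^ 2 / 2)) := by
  induction p using Polynomial.induction_on' with
  | add p q hp hq => simpa only [eval_add, add_mul] using! hp.add hq
  | monomial k c =>
    have h := (integrable_rpow_mul_exp_neg_mul_sq (b := 1 / 2) (by norm_num)
      (s := k) (by linarith [k.cast_nonneg (α := ℝ)])).const_mul c
    refine h.congr (.of_forall fun x => ?_)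
    simp only [eval_monomial, Real.rpow_natCast]
    ring_nf

/-- The `n`-th order term of the Gram-Charlier formula: for `n ≥ 3`,
`c₂ > 0` and `d := (c₁ − a)/√c₂`,
`∫_a^∞ x·(1/√c₂)·H_n((x−c₁)/√c₂)·φ((x−c₁)/√c₂) dx
  = (−1)^{n−1}·φ(d)·(a·H_{n−1}(d) − √c₂·H_{n−2}(d))`. -/
theorem gram_charlier_nth_order_term
    (φ : ℝ → ℝ) (hφ : ∀ x, φ x = (Real.sqrt (2 * Real.pi))⁻¹ * Real.exp (-x ^ 2 / 2))
    (n : ℕ) (hn : 3 ≤ n) (c₁ c₂ a : ℝ) (hc₂ : 0 < c₂)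
    (d : ℝ) (hd : d = (c₁ - a) / Real.sqrt c₂) :
    ∫ x in Set.Ioi a,
        x * (Real.sqrt c₂)⁻¹ * (aeval ((x - c₁) / Real.sqrt c₂) (hermite n)) *
          φ ((x - c₁) / Real.sqrt c₂)
      = (-1 : ℝ) ^ (n - 1) * φ d *
          (a * aeval d (hermite (n - 1)) - Real.sqrt c₂ * aeval d (hermite (n - 2))) := by
  obtain ⟨m, rfl⟩ : ∃ m, n = m + 2 := ⟨n - 2, by omega⟩
  have hs : 0 < Real.sqrt c₂ := Real.sqrt_pos.2 hc₂
  simp only [show m + 2 - 1 = m + 1 by omega, Nat.add_sub_cancel, hφ]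
  generalize Real.sqrt c₂ = s at *
  generalize (Real.sqrt (2 * Real.pi))⁻¹ = κ
  have hint (p : ℝ[X]) :
      Integrable (fun x : ℝ => p.eval ((x - c₁) / s) * Real.exp (-((x - c₁) / s) ^ 2 / 2)) :=
    ((integrable_eval_mul_exp_neg_sq_div_two p).comp_div hs.ne').comp_sub_right c₁
  have haff (x : ℝ) : c₁ + s * ((x - c₁) / s) = x := by field_simp; ring
  have haeval (k : ℕ) (y : ℝ) :
      ((hermite k).map (algebraMap ℤ ℝ)).eval y = aeval y (hermite k) := eval_map_algebraMap _ _
  set F : ℝ → ℝ := fun x =>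
    -κ * (x * (aeval ((x - c₁) / s) (hermite (m + 1)) * Real.exp (-((x - c₁) / s) ^ 2 / 2))
      + s * (aeval ((x - c₁) / s) (hermite m) * Real.exp (-((x - c₁) / s) ^ 2 / 2))) with hF
  have hderiv (x : ℝ) : HasDerivAt F
      (x * s⁻¹ * aeval ((x - c₁) / s) (hermite (m + 2)) *
        (κ * Real.exp (-((x - c₁) / s) ^ 2 / 2))) x := by
    have hu : HasDerivAt (fun x : ℝ => (x - c₁) / s) (1 / s) x :=
      ((hasDerivAt_id x).sub_const c₁).div_const s
    have h (k : ℕ) := (hasDerivAt_hermite_mul_exp k ((x - c₁) / s)).comp x hu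
    refine ((((hasDerivAt_id x).mul (h (m + 1))).add
      ((h m).const_mul s)).const_mul (-κ)).congr_deriv ?_
    simp only [Function.comp, id]
    field_simp
    ring
  have hF_int : Integrable F := by
    refine (hint (C (-κ) * ((C c₁ + C s * X) * (hermite (m + 1)).map (algebraMap ℤ ℝ)
      + C s * (hermite m).map (algebraMap ℤ ℝ)))).congr (.of_forall fun x => ?_)
    simp only [eval_mul, eval_add, eval_C, eval_X, haeval, haff, hF]
    ring
  have hF'_int : Integrable (fun x : ℝ => x * s⁻¹ * aeval ((x - c₁) / s) (hermite (m + 2)) *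
        (κ * Real.exp (-((x - c₁) / s) ^ 2 / 2))) := by
    refine (hint (C (κ * s⁻¹) * (C c₁ + C s * X) *
      (hermite (m + 2)).map (algebraMap ℤ ℝ))).congr (.of_forall fun x => ?_)
    simp only [eval_mul, eval_add, eval_C, eval_X, haeval, haff]
    ring
  have hlim := tendsto_zero_of_hasDerivAt_of_integrableOn_Ioi (a := a) (fun x _ => hderiv x)
    hF'_int.integrableOn hF_int.integrableOn
  rw [integral_Ioi_of_hasDerivAt_of_tendsto' (fun x _ => hderiv x) hF'_int.integrableOn hlim]
  have hda : (a - c₁) / s = -d := by rw [hd]; ring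
  simp only [hF, hda, aeval_neg_hermite, neg_sq]
  ring
end

section
/- Let φ₁ > 0, φ₂ ≥ 0, φ₃ ≥ 0 and t ≤ T. Define A(t,T) := ( φ₁·e^{φ₂(T−t)} / (φ₂(e^{φ₁(T−t)} − 1) + φ₁) )^{φ₃} and B(t,T) := (e^{φ₁(T−t)} − 1) / (φ₂(e^{φ₁(T−t)} − 1) + φ₁). Then A(T,T) = 1 and B(T,T) = 0, A(t,T) > 0 and B(t,T) ≥ 0 for all t ≤ T, and, fixing T and viewing A and B as functions of t, they satisfy on (−∞, T] the terminal-value system: ∂_t B(t,T) = −1 + (2φ₂ − φ₁)·B(t,T) + (φ₂φ₁ − φ₂²)·B(t,T)² and ∂_t (log A)(t,T) = φ₂·φ₃·(φ₁ − φ₂)·B(t,T). -/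
/-- Derivative in `t` of the common denominator of the CIR− coefficient functions. -/
theorem hasDerivAt_cir_denominator (a b T t : ℝ) :
    HasDerivAt (fun s => b * (Real.exp (a * (T - s)) - 1) + a)
      (-(a * b * Real.exp (a * (T - t)))) t := by
  have h := (((((hasDerivAt_id t).const_sub T).const_mul a).exp.sub_const 1).const_mul b).add_const a
  refine h.congr_deriv ?_
  simp only [id]
  ring

theorem cir_denominator_pos {a b T t : ℝ} (ha : 0 < a) (hb : 0 ≤ b) (ht : t ≤ T) :
    0 < b * (Real.exp (a * (T - t)) - 1) + a := by
  have h : 1 ≤ Real.exp (a * (T - t)) :=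
    Real.one_le_exp (mul_nonneg ha.le (sub_nonneg.2 ht))
  have := mul_nonneg hb (sub_nonneg.2 h)
  linarith

theorem hasDerivAt_cir_riccati {a b T t : ℝ}
    (hD : b * (Real.exp (a * (T - t)) - 1) + a ≠ 0) (B : ℝ → ℝ)
    (hB : ∀ t, B t = (Real.exp (a * (T - t)) - 1) / (b * (Real.exp (a * (T - t)) - 1) + a)) :
    HasDerivAt B (-1 + (2 * b - a) * B t + (b * a - b ^ 2) * (B t) ^ 2) t := by
  have hu : HasDerivAt (fun s => Real.exp (a * (T - s)) - 1)
      (-(a * Real.exp (a * (T - t)))) t := by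
    refine ((((hasDerivAt_id t).const_sub T).const_mul a).exp.sub_const 1).congr_deriv ?_
    simp only [id]
    ring
  have h := hu.fun_div (hasDerivAt_cir_denominator a b T t) hD
  rw [← funext hB] at h
  refine h.congr_deriv ?_
  rw [hB]
  generalize Real.exp (a * (T - t)) = E at hD ⊢
  field_simp
  ring

theorem hasDerivAt_log_cir_coefficient {a b c T t : ℝ} (ha : 0 < a)
    (hD : 0 < b * (Real.exp (a * (T - t)) - 1) + a) :
    HasDerivAt (fun s => Real.log ((a * Real.exp (b * (T - s)) /
        (b * (Real.exp (a * (T - s)) - 1) + a)) ^ c))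
      (b * c * (a - b) *
        ((Real.exp (a * (T - t)) - 1) / (b * (Real.exp (a * (T - t)) - 1) + a))) t := by
  have hden := hasDerivAt_cir_denominator a b T t
  have h : HasDerivAt (fun s => c * (Real.log a + b * (T - s) -
      Real.log (b * (Real.exp (a * (T - s)) - 1) + a)))
      (b * c * (a - b) *
        ((Real.exp (a * (T - t)) - 1) / (b * (Real.exp (a * (T - t)) - 1) + a))) t := by
    refine HasDerivAt.congr_deriv
      ((((((hasDerivAt_id t).const_sub T).const_mul b).const_add (Real.log a)).fun_sub
        (hden.log hD.ne')).const_mul c) ?_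
    generalize Real.exp (a * (T - t)) = E at hD ⊢
    have := hD.ne'
    field_simp
    ring
  refine h.congr_of_eventuallyEq ?_
  filter_upwards [hden.continuousAt.eventually_const_lt hD] with s hs
  have he := Real.exp_pos (b * (T - s))
  rw [Real.log_rpow (by positivity), Real.log_div (by positivity) hs.ne',
    Real.log_mul ha.ne' he.ne', Real.log_exp]

/-- The explicit coefficient functions `A(·,T)`, `B(·,T)` of the CIR− bond
price satisfy the terminal-value Riccati system (in the reparametrized coefficients):
`A(T,T) = 1`, `B(T,T) = 0`, `A > 0` and `B ≥ 0` on `(-∞, T]`, and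
`∂_t B = −1 + (2φ₂ − φ₁)B + (φ₂φ₁ − φ₂²)B²`, `∂_t (log A) = φ₂φ₃(φ₁ − φ₂)B`. -/
theorem cir_minus_bond_coefficients_riccati_system
    (φ₁ φ₂ φ₃ T : ℝ) (hφ₁ : 0 < φ₁) (hφ₂ : 0 ≤ φ₂) (hφ₃ : 0 ≤ φ₃)
    (A B : ℝ → ℝ)
    (hA : ∀ t, A t =
      (φ₁ * Real.exp (φ₂ * (T - t)) /
        (φ₂ * (Real.exp (φ₁ * (T - t)) - 1) + φ₁)) ^ φ₃)
    (hB : ∀ t, B t =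
      (Real.exp (φ₁ * (T - t)) - 1) / (φ₂ * (Real.exp (φ₁ * (T - t)) - 1) + φ₁)) :
    A T = 1 ∧ B T = 0 ∧
    (∀ t ≤ T, 0 < A t ∧ 0 ≤ B t) ∧
    (∀ t ≤ T,
      HasDerivAt B (-1 + (2 * φ₂ - φ₁) * B t + (φ₂ * φ₁ - φ₂ ^ 2) * (B t) ^ 2) t ∧
      HasDerivAt (fun s => Real.log (A s)) (φ₂ * φ₃ * (φ₁ - φ₂) * B t) t) := by
  refine ⟨?_, ?_, fun t ht => ⟨?_, ?_⟩, fun t ht => ⟨?_, ?_⟩⟩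
  · simp [hA, hφ₁.ne']
  · simp [hB]
  · have := cir_denominator_pos hφ₁ hφ₂ ht
    rw [hA]
    positivity
  · rw [hB]
    exact div_nonneg (sub_nonneg.2 (Real.one_le_exp (mul_nonneg hφ₁.le (sub_nonneg.2 ht))))
      (cir_denominator_pos hφ₁ hφ₂ ht).le
  · exact hasDerivAt_cir_riccati (cir_denominator_pos hφ₁ hφ₂ ht).ne' B hB
  · simp only [hA, hB]
    exact hasDerivAt_log_cir_coefficient hφ₁ (cir_denominator_pos hφ₁ hφ₂ ht)
end
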